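/- Fix T ∈ ℤ and a bounded sequence y : ℤ → ℝ^m. For L ∈ S define the steady-state prediction error e(L) := y(T) − Σ_{t=0}^∞ H·A_L^t·L·y(T−t−1) (the series converges since ρ(A_L) < 1 and y is bounded) and ε(L) := ‖e(L)‖². Then ε is Fréchet differentiable at every L ∈ S, and its Frobenius gradient equals −2·Σ_{t=0}^∞ (A_Lᵀ)^t·Hᵀ·e(L)·y(T−t−1)ᵀ + 2·Σ_{t=1}^∞ Σ_{k=1}^t (A_Lᵀ)^{t−k}·Hᵀ·e(L)·y(T−t−1)ᵀ·Lᵀ·(A_Lᵀ)^{k−1}·Hᵀ; that is, for every n×m real matrix Δ, the Fréchet derivative of ε at L applied to Δ equals the Frobenius inner product tr(Gᵀ·Δ) of Δ with the above matrix G. -/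

import Mathlib

open Matrix Filter Topology

attribute [local instance] Matrix.normedAddCommGroup Matrix.normedSpace

/-- Spectral radius of a real square matrix: the maximum modulus of its complex
eigenvalues. -/
noncomputable def specRad {n : ℕ} (M : Matrix (Fin n) (Fin n) ℝ) : ENNReal :=
  spectralRadius ℂ (M.map (Complex.ofReal))

theorem norm_pow_le_of_norm_pow_le {R : Type*} [NormedRing R] [NormOneClass R] {a : R}
    {K s : ℝ} {N : ℕ} (hN : 0 < N) (hs : 0 < s) (hs1 : s < 1) (hK : 1 ≤ K) (haK : ‖a‖ ≤ K)
    (haN : ‖a ^ N‖ ≤ s ^ N) (t : ℕ) : ‖a ^ t‖ ≤ (K / s) ^ N * s ^ t := by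
  have hKs : 1 ≤ K / s := by rw [le_div_iff₀ hs]; linarith
  calc ‖a ^ t‖ = ‖(a ^ N) ^ (t / N) * a ^ (t % N)‖ := by
        rw [← pow_mul, ← pow_add, Nat.div_add_mod]
    _ ≤ ‖a ^ N‖ ^ (t / N) * ‖a‖ ^ (t % N) :=
        (norm_mul_le _ _).trans (mul_le_mul (norm_pow_le _ _) (norm_pow_le _ _)
          (norm_nonneg _) (by positivity))
    _ ≤ (s ^ N) ^ (t / N) * K ^ (t % N) := by gcongr
    _ = (K / s) ^ (t % N) * s ^ t := by
        have h : s ^ t = (s ^ N) ^ (t / N) * s ^ (t % N) := by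
          rw [← pow_mul, ← pow_add, Nat.div_add_mod]
        rw [h, div_pow]
        field_simp
    _ ≤ (K / s) ^ N * s ^ t := by
        gcongr
        exact (Nat.mod_lt _ hN).le

theorem exists_norm_pow_lt_of_spectralRadius_lt_one {R : Type*} [NormedRing R] [NormedAlgebra ℂ R]
    [CompleteSpace R] {a : R} (ha : spectralRadius ℂ a < 1) :
    ∃ s : ℝ, 0 < s ∧ s < 1 ∧ ∃ N : ℕ, 0 < N ∧ ‖a ^ N‖ < s ^ N := by
  obtain ⟨s, has, hs1⟩ := ENNReal.lt_iff_exists_nnreal_btwn.1 ha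
  have hs0 : 0 < s := by
    have := zero_le.trans_lt has
    exact_mod_cast this
  have hlim := spectrum.pow_nnnorm_pow_one_div_tendsto_nhds_spectralRadius a
  obtain ⟨N, hN, hN0⟩ := ((hlim.eventually (gt_mem_nhds has)).and (eventually_gt_atTop 0)).exists
  refine ⟨s, hs0, by exact_mod_cast hs1, N, hN0, ?_⟩
  have hN0' : (0 : ℝ) < N := by exact_mod_cast hN0
  have h := ENNReal.rpow_lt_rpow hN hN0'
  rw [← ENNReal.rpow_mul, one_div_mul_cancel hN0'.ne', ENNReal.rpow_one,
    ENNReal.rpow_natCast] at h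
  exact_mod_cast h

section PowerSeries

variable {E V W : Type*} [NormedAddCommGroup E] [NormedSpace ℝ E] [NormedAddCommGroup V]
  [NormedSpace ℝ V] [NormedAddCommGroup W] [NormedSpace ℝ W]

/-- The part of the derivative of `x ↦ h ((a x) ^ t (c x))` coming from `c`. -/
noncomputable def inputDeriv (h : V →L[ℝ] W) (c : E →L[ℝ] V) (b : V →L[ℝ] V) (t : ℕ) :
    E →L[ℝ] W :=
  h ∘L (b ^ t) ∘L c

/-- The part of the derivative of `x ↦ h ((a₀ - α x) ^ t v)` coming from the power. -/
noncomputable def powerDeriv (h : V →L[ℝ] W) (α : E →L[ℝ] V →L[ℝ] V) (b : V →L[ℝ] V) (v : V)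
    (t : ℕ) : E →L[ℝ] W :=
  -∑ i ∈ Finset.range t, h ∘L (b ^ (t - 1 - i)) ∘L α.flip ((b ^ i) v)

theorem inputDeriv_apply (h : V →L[ℝ] W) (c : E →L[ℝ] V) (b : V →L[ℝ] V) (t : ℕ) (Δ : E) :
    inputDeriv h c b t Δ = h ((b ^ t) (c Δ)) := rfl

theorem powerDeriv_apply (h : V →L[ℝ] W) (α : E →L[ℝ] V →L[ℝ] V) (b : V →L[ℝ] V) (v : V)
    (t : ℕ) (Δ : E) : powerDeriv h α b v t Δ =
      -∑ i ∈ Finset.range t, h ((b ^ (t - 1 - i)) (α Δ ((b ^ i) v))) := by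
  simp [powerDeriv]

theorem hasFDerivAt_pow_apply (h : V →L[ℝ] W) (α : E →L[ℝ] V →L[ℝ] V) (a₀ : V →L[ℝ] V)
    (c : E →L[ℝ] V) (t : ℕ) (x : E) :
    HasFDerivAt (fun x => h (((a₀ - α x) ^ t) (c x)))
      (inputDeriv h c (a₀ - α x) t + powerDeriv h α (a₀ - α x) (c x) t) x := by
  have ha : HasFDerivAt (fun x => a₀ - α x) (-α) x := α.hasFDerivAt.const_sub a₀
  have hp := (ha.fun_pow' t).clm_apply c.hasFDerivAt
  have hh := h.hasFDerivAt.comp x hp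
  have heq : h ∘L (((a₀ - α x) ^ t) ∘L c + (∑ i ∈ Finset.range t,
      MulOpposite.op ((a₀ - α x) ^ i) • (a₀ - α x) ^ (t.pred - i) • -α).flip (c x)) =
      inputDeriv h c (a₀ - α x) t + powerDeriv h α (a₀ - α x) (c x) t := by
    ext Δ
    rw [_root_.add_apply, inputDeriv_apply, powerDeriv_apply,
      ContinuousLinearMap.comp_apply, _root_.add_apply, map_add,
      ContinuousLinearMap.flip_apply, _root_.sum_apply,
      _root_.sum_apply, map_sum, ← Finset.sum_neg_distrib]
    refine congrArg₂ _ rfl (Finset.sum_congr rfl fun i _ => ?_)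
    rw [← map_neg, ← map_neg, ← _root_.neg_apply]
    rfl
  rw [← heq]
  exact hh

theorem norm_inputDeriv_le {h : V →L[ℝ] W} {c : E →L[ℝ] V} {b : V →L[ℝ] V} {t : ℕ} {C Y s : ℝ}
    (hb : ‖b ^ t‖ ≤ C * s ^ t) (hc : ‖c‖ ≤ Y) :
    ‖inputDeriv h c b t‖ ≤ ‖h‖ * C * Y * s ^ t := by
  have hY : 0 ≤ Y := (norm_nonneg _).trans hc
  calc ‖inputDeriv h c b t‖ ≤ ‖h‖ * (‖b ^ t‖ * ‖c‖) :=
        (h.opNorm_comp_le _).trans (by gcongr; exact ContinuousLinearMap.opNorm_comp_le _ _)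
    _ ≤ ‖h‖ * ((C * s ^ t) * Y) := by gcongr; exact (norm_nonneg _).trans hb
    _ = _ := by ring

theorem norm_powerDeriv_le {h : V →L[ℝ] W} {α : E →L[ℝ] V →L[ℝ] V} {b : V →L[ℝ] V} {v : V}
    {t : ℕ} {C Y s : ℝ} (hs : 0 < s) (hC : 0 ≤ C) (hb : ∀ t, ‖b ^ t‖ ≤ C * s ^ t)
    (hv : ‖v‖ ≤ Y) :
    ‖powerDeriv h α b v t‖ ≤ ‖h‖ * C * ‖α‖ * C * Y / s * (t * s ^ t) := by
  have hY : 0 ≤ Y := (norm_nonneg _).trans hv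
  rw [powerDeriv, norm_neg]
  have key : ∀ i ∈ Finset.range t, ‖h ∘L (b ^ (t - 1 - i)) ∘L α.flip ((b ^ i) v)‖ ≤
      ‖h‖ * C * ‖α‖ * C * Y / s * s ^ t := by
    intro i hi
    have hit := Finset.mem_range.1 hi
    calc _ ≤ ‖h‖ * (‖b ^ (t - 1 - i)‖ * (‖α‖ * (‖b ^ i‖ * ‖v‖))) := by
          refine (h.opNorm_comp_le _).trans ?_
          gcongr
          refine (ContinuousLinearMap.opNorm_comp_le _ _).trans ?_
          gcongr
          refine (α.flip.le_opNorm _).trans ?_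
          rw [ContinuousLinearMap.opNorm_flip]
          gcongr
          exact ContinuousLinearMap.le_opNorm _ _
      _ ≤ ‖h‖ * ((C * s ^ (t - 1 - i)) * (‖α‖ * ((C * s ^ i) * Y))) := by
          gcongr
          · exact hb _
          · exact hb _
      _ = _ := by
          have : s ^ t = s ^ (t - 1 - i) * s ^ i * s := by
            rw [← pow_add, ← pow_succ]; congr 1; omega
          rw [this]
          field_simp
  calc _ ≤ ∑ i ∈ Finset.range t, ‖h ∘L (b ^ (t - 1 - i)) ∘L α.flip ((b ^ i) v)‖ :=
        norm_sum_le _ _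
    _ ≤ ∑ i ∈ Finset.range t, ‖h‖ * C * ‖α‖ * C * Y / s * s ^ t := Finset.sum_le_sum key
    _ = _ := by simp; ring

theorem hasFDerivAt_tsum_pow_apply [CompleteSpace W] [Nontrivial V] (h : V →L[ℝ] W)
    (α : E →L[ℝ] V →L[ℝ] V) (a₀ : V →L[ℝ] V) (c : ℕ → E →L[ℝ] V) {Y : ℝ} (hc : ∀ t, ‖c t‖ ≤ Y)
    (x : E) {s : ℝ} (hs : 0 < s) (hs1 : s < 1) {N : ℕ} (hN : 0 < N)
    (hx : ‖(a₀ - α x) ^ N‖ < s ^ N) :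
    Summable (fun t => inputDeriv h (c t) (a₀ - α x) t) ∧
    Summable (fun t => powerDeriv h α (a₀ - α x) (c t x) t) ∧
    HasFDerivAt (fun x => ∑' t, h (((a₀ - α x) ^ t) (c t x)))
      (∑' t, inputDeriv h (c t) (a₀ - α x) t + ∑' t, powerDeriv h α (a₀ - α x) (c t x) t) x := by
  have hY : 0 ≤ Y := (norm_nonneg _).trans (hc 0)
  set K : ℝ := ‖a₀ - α x‖ + 1 with hK
  set C : ℝ := (K / s) ^ N
  have hC0 : 0 ≤ C := by positivity
  have h1 : ∀ᶠ z in 𝓝 x, ‖(a₀ - α z) ^ N‖ < s ^ N :=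
    (show Continuous fun z => ‖(a₀ - α z) ^ N‖ by fun_prop).continuousAt.eventually
      (gt_mem_nhds hx)
  have h2 : ∀ᶠ z in 𝓝 x, ‖a₀ - α z‖ < K :=
    (show Continuous fun z => ‖a₀ - α z‖ by fun_prop).continuousAt.eventually
      (gt_mem_nhds (by linarith))
  obtain ⟨δ, hδ, hball⟩ := Metric.eventually_nhds_iff_ball.1 (h1.and h2)
  have hpow : ∀ z ∈ Metric.ball x δ, ∀ t, ‖(a₀ - α z) ^ t‖ ≤ C * s ^ t := fun z hz t =>
    norm_pow_le_of_norm_pow_le hN hs hs1 (by simp [hK]) (hball z hz).2.le (hball z hz).1.le t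
  set R : ℝ := ‖x‖ + δ with hR
  have hcz : ∀ z ∈ Metric.ball x δ, ∀ t, ‖c t z‖ ≤ Y * R := by
    intro z hz t
    have : ‖z‖ ≤ R := by
      have h3 := norm_add_le x (z - x)
      rw [mem_ball_iff_norm] at hz
      rw [add_sub_cancel] at h3
      linarith
    exact ((c t).le_opNorm z).trans (mul_le_mul (hc t) this (norm_nonneg _) hY)
  have hgeo : Summable fun t : ℕ => s ^ t := summable_geometric_of_lt_one hs.le hs1
  have hgeo' : Summable fun t : ℕ => (t : ℝ) * s ^ t := by
    simpa using summable_pow_mul_geometric_of_norm_lt_one 1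
      (r := s) (by rwa [Real.norm_of_nonneg hs.le])
  have hu := hgeo.mul_left (‖h‖ * C * Y)
  have hu' := hgeo'.mul_left (‖h‖ * C * ‖α‖ * C * (Y * R) / s)
  have hxb : x ∈ Metric.ball x δ := Metric.mem_ball_self hδ
  have hP := fun z hz t => norm_inputDeriv_le (h := h) (hpow z hz t) (hc t)
  have hQ := fun z hz t => norm_powerDeriv_le (h := h) (α := α) (t := t) hs hC0 (hpow z hz)
    (hcz z hz t)
  have hPs := Summable.of_norm_bounded hu (hP x hxb)
  have hQs := Summable.of_norm_bounded hu' (hQ x hxb)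
  refine ⟨hPs, hQs, ?_⟩
  rw [← hPs.tsum_add hQs]
  refine hasFDerivAt_tsum_of_isPreconnected (hu.add hu') Metric.isOpen_ball
    (convex_ball x δ).isPreconnected (fun t z _ => hasFDerivAt_pow_apply h α a₀ (c t) t z)
    (fun t z hz => (norm_add_le _ _).trans (add_le_add (hP z hz t) (hQ z hz t))) hxb ?_ hxb
  exact hPs.mapL (ContinuousLinearMap.apply ℝ W x)

end PowerSeries

section MatrixMaps

variable {n m p : ℕ}

/-- Multiplication of vectors by a matrix, as a continuous linear map depending linearly on the
matrix. -/
noncomputable def mulVecCLM (p q : ℕ) :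
    Matrix (Fin p) (Fin q) ℝ →ₗ[ℝ] (Fin q → ℝ) →L[ℝ] (Fin p → ℝ) :=
  LinearMap.toContinuousLinearMap.toLinearMap ∘ₗ (Matrix.toLin' (R := ℝ)).toLinearMap

theorem mulVecCLM_apply {p q : ℕ} (M : Matrix (Fin p) (Fin q) ℝ) (v : Fin q → ℝ) :
    mulVecCLM p q M v = M *ᵥ v := rfl

theorem mulVecCLM_pow_apply (M : Matrix (Fin n) (Fin n) ℝ) (t : ℕ) (v : Fin n → ℝ) :
    (mulVecCLM n n M ^ t) v = M ^ t *ᵥ v := by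
  induction t generalizing v with
  | zero => simp
  | succ t ih => rw [pow_succ, pow_succ, mul_apply_eq_comp, ih, mulVecCLM_apply,
      Matrix.mulVec_mulVec]

theorem exists_norm_mulVecCLM_pow_lt_of_specRad_lt_one {M : Matrix (Fin n) (Fin n) ℝ}
    (hM : specRad M < 1) :
    ∃ s : ℝ, 0 < s ∧ s < 1 ∧ ∃ N : ℕ, 0 < N ∧ ‖mulVecCLM n n M ^ N‖ < s ^ N := by
  let F : Matrix (Fin n) (Fin n) ℂ ≃ₐ[ℂ] (Fin n → ℂ) →L[ℂ] (Fin n → ℂ) :=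
    Matrix.toLinAlgEquiv'.trans (Module.End.toContinuousLinearMap (Fin n → ℂ))
  have hF : ∀ X v, F X v = X *ᵥ v := fun _ _ => rfl
  have hspec : spectralRadius ℂ (F (M.map Complex.ofReal)) < 1 := by
    rw [spectralRadius, AlgEquiv.spectrum_eq]
    exact hM
  obtain ⟨s, hs, hs1, N, hN, h⟩ := exists_norm_pow_lt_of_spectralRadius_lt_one hspec
  refine ⟨s, hs, hs1, N, hN, lt_of_le_of_lt ?_ h⟩
  refine ContinuousLinearMap.opNorm_le_bound _ (norm_nonneg _) fun v => ?_
  have hnorm : ∀ w : Fin n → ℝ, ‖(fun i => (w i : ℂ))‖ = ‖w‖ := fun w => by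
    simp [Pi.norm_def]
  have hmap : (F (M.map Complex.ofReal) ^ N) (fun i => (v i : ℂ)) =
      fun i => (((M ^ N *ᵥ v) i : ℝ) : ℂ) := by
    have hpow : M.map Complex.ofReal ^ N = (M ^ N).map Complex.ofReal :=
      (Matrix.map_pow M Complex.ofRealHom N).symm
    rw [← map_pow, hF, hpow]
    ext i
    simp [Matrix.mulVec, dotProduct]
  rw [mulVecCLM_pow_apply, ← hnorm, ← hnorm v, ← hmap]
  exact ContinuousLinearMap.le_opNorm _ _

theorem trace_vecMulVec_mul (v : Fin m → ℝ) (w : Fin p → ℝ) (M : Matrix (Fin p) (Fin m) ℝ) :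
    Matrix.trace (vecMulVec v w * M) = w ⬝ᵥ M *ᵥ v := by
  rw [Matrix.vecMulVec_mul, Matrix.trace_vecMulVec, dotProduct_comm, Matrix.dotProduct_mulVec]

theorem trace_transpose_tsum_mul {S : ℕ → Matrix (Fin n) (Fin m) ℝ}
    {φ : Matrix (Fin n) (Fin m) ℝ → ℝ}
    (h : ∀ Δ, HasSum (fun t => Matrix.trace ((S t)ᵀ * Δ)) (φ Δ)) (Δ : Matrix (Fin n) (Fin m) ℝ) :
    Matrix.trace ((∑' t, S t)ᵀ * Δ) = φ Δ := by
  have hS : Summable S := by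
    refine Pi.summable.2 fun i => Pi.summable.2 fun j => ?_
    refine (h (Matrix.single i j 1)).summable.congr fun t => ?_
    simp [Matrix.trace_mul_single]
  let f : Matrix (Fin n) (Fin m) ℝ →+ ℝ :=
    { toFun := fun X => Matrix.trace (Xᵀ * Δ)
      map_zero' := by simp
      map_add' := fun X Y => by simp [Matrix.add_mul] }
  have hf : Continuous f :=
    (continuous_id.matrix_transpose.matrix_mul continuous_const).matrix_trace
  exact (hS.hasSum.map f hf).unique (h Δ)

theorem hasFDerivAt_predictionError_sq {E : Type*} [NormedAddCommGroup E] [NormedSpace ℝ E]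
    [FiniteDimensional ℝ E] (ι : E ≃ₗ[ℝ] Matrix (Fin n) (Fin m) ℝ)
    (hn : 0 < n) (A : Matrix (Fin n) (Fin n) ℝ) (H : Matrix (Fin m) (Fin n) ℝ)
    (T : ℤ) (y : ℤ → Fin m → ℝ) (hybd : ∃ C : ℝ, ∀ (t : ℤ) (i : Fin m), |y t i| ≤ C)
    (e : Matrix (Fin n) (Fin m) ℝ → Fin m → ℝ)
    (he : ∀ L, e L = y T -
      ∑' t : ℕ, (H * (A - L * H) ^ t * L).mulVec (y (T - (t : ℤ) - 1)))
    (x : E) (hx : specRad (A - ι x * H) < 1) :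
    ∃ ε' : E →L[ℝ] ℝ, HasFDerivAt (fun z => e (ι z) ⬝ᵥ e (ι z)) ε' x ∧
      ∀ Δ : E, ε' Δ = Matrix.trace (((-2 : ℝ) • (∑' t : ℕ,
        ((A - ι x * H)ᵀ) ^ t * Hᵀ * vecMulVec (e (ι x)) (y (T - (t : ℤ) - 1))) +
      (2 : ℝ) • (∑' t : ℕ, ∑ k ∈ Finset.range (t + 1),
        ((A - ι x * H)ᵀ) ^ (t - k) * Hᵀ * vecMulVec (e (ι x)) (y (T - (t : ℤ) - 2)) *
          (ι x)ᵀ * ((A - ι x * H)ᵀ) ^ k * Hᵀ))ᵀ * ι Δ) := by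
  have : NeZero n := ⟨hn.ne'⟩
  obtain ⟨C, hC⟩ := hybd
  have hyC : ∀ t, ‖y t‖ ≤ |C| := fun t =>
    (pi_norm_le_iff_of_nonneg (abs_nonneg C)).2 fun i => (hC t i).trans (le_abs_self C)
  obtain ⟨s, hs, hs1, N, hN, hnorm⟩ := exists_norm_mulVecCLM_pow_lt_of_specRad_lt_one hx
  set κ : E →L[ℝ] (Fin m → ℝ) →L[ℝ] (Fin n → ℝ) :=
    LinearMap.toContinuousLinearMap (mulVecCLM n m ∘ₗ ι.toLinearMap)
  set h := mulVecCLM m n H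
  set α : E →L[ℝ] (Fin n → ℝ) →L[ℝ] (Fin n → ℝ) :=
    (ContinuousLinearMap.compL ℝ (Fin n → ℝ) (Fin m → ℝ) (Fin n → ℝ)).flip h ∘L κ
  set a₀ := mulVecCLM n n A with ha₀
  set c : ℕ → E →L[ℝ] (Fin n → ℝ) := fun t => κ.flip (y (T - (t : ℤ) - 1))
  have hα_apply : ∀ z v, α z v = ι z *ᵥ (H *ᵥ v) := fun _ _ => rfl
  have hc_apply : ∀ t z, c t z = ι z *ᵥ y (T - (t : ℤ) - 1) := fun _ _ => rfl
  have hh_apply : ∀ v, h v = H *ᵥ v := fun _ => rfl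
  have hclosed : ∀ z, a₀ - α z = mulVecCLM n n (A - ι z * H) := by
    intro z
    ext1 v
    rw [_root_.sub_apply, hα_apply, ha₀, mulVecCLM_apply, mulVecCLM_apply, Matrix.sub_mulVec,
      Matrix.mulVec_mulVec]
  have hpow : ∀ z t v, ((a₀ - α z) ^ t) v = (A - ι z * H) ^ t *ᵥ v := fun z t v => by
    rw [hclosed, mulVecCLM_pow_apply]
  have hcn : ∀ t, ‖c t‖ ≤ ‖κ‖ * |C| := fun t => by
    refine (κ.flip.le_opNorm _).trans ?_
    rw [ContinuousLinearMap.opNorm_flip]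
    gcongr
    exact hyC _
  obtain ⟨hP, hQ, hD⟩ := hasFDerivAt_tsum_pow_apply h α a₀ c hcn x hs hs1 hN
    (by rw [hclosed]; exact hnorm)
  set P := fun t => inputDeriv h (c t) (a₀ - α x) t
  set Q := fun t => powerDeriv h α (a₀ - α x) (c t x) t with hQdef
  have hDe : HasFDerivAt (fun z => e (ι z)) (-(∑' t, P t + ∑' t, Q t)) x := by
    refine (hD.const_sub (y T)).congr_of_eventuallyEq (Eventually.of_forall fun z => ?_)
    simp only [he, hpow, hc_apply, hh_apply, Matrix.mulVec_mulVec, Matrix.mul_assoc]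
  have hcoord := hasFDerivAt_pi'.1 hDe
  refine ⟨_, HasFDerivAt.fun_sum fun i _ => (hcoord i).mul (hcoord i), fun Δ => ?_⟩
  have hdot : ∀ {F : ℕ → E →L[ℝ] Fin m → ℝ}, Summable F → ∀ Δ,
      HasSum (fun t => e (ι x) ⬝ᵥ F t Δ) (e (ι x) ⬝ᵥ (∑' t, F t) Δ) := by
    intro F hF Δ
    have h1 := hF.hasSum.mapL (ContinuousLinearMap.apply ℝ (Fin m → ℝ) Δ)
    exact hasSum_sum fun i _ => (Pi.hasSum.1 h1 i).mul_left (e (ι x) i)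
  have htrP : Matrix.trace ((∑' t : ℕ, ((A - ι x * H)ᵀ) ^ t * Hᵀ *
      vecMulVec (e (ι x)) (y (T - (t : ℤ) - 1)))ᵀ * ι Δ) = e (ι x) ⬝ᵥ (∑' t, P t) Δ := by
    rw [trace_transpose_tsum_mul (φ := fun X => e (ι x) ⬝ᵥ (∑' t, P t) (ι.symm X)),
      LinearEquiv.symm_apply_apply]
    intro X
    convert hdot hP (ι.symm X) using 2 with t
    rw [inputDeriv_apply, hpow, hc_apply, hh_apply, LinearEquiv.apply_symm_apply,
      Matrix.transpose_mul, Matrix.transpose_vecMulVec, Matrix.transpose_mul, Matrix.transpose_pow,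
      Matrix.transpose_transpose, Matrix.transpose_transpose, Matrix.mul_assoc,
      trace_vecMulVec_mul]
    simp only [Matrix.mulVec_mulVec, Matrix.mul_assoc]
  have htrQ : Matrix.trace ((∑' t : ℕ, ∑ k ∈ Finset.range (t + 1),
      ((A - ι x * H)ᵀ) ^ (t - k) * Hᵀ * vecMulVec (e (ι x)) (y (T - (t : ℤ) - 2)) *
        (ι x)ᵀ * ((A - ι x * H)ᵀ) ^ k * Hᵀ)ᵀ * ι Δ) = -(e (ι x) ⬝ᵥ (∑' t, Q t) Δ) := by
    rw [trace_transpose_tsum_mul (φ := fun X => -(e (ι x) ⬝ᵥ (∑' t, Q t) (ι.symm X))),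
      LinearEquiv.symm_apply_apply]
    intro X
    have hQ0 : Q 0 (ι.symm X) = 0 := by simp [hQdef, powerDeriv_apply]
    have hshift := (hasSum_nat_add_iff' 1).2 (hdot hQ (ι.symm X))
    simp only [Finset.sum_range_one, hQ0, dotProduct_zero, sub_zero] at hshift
    have hterm : ∀ t : ℕ, Matrix.trace ((∑ k ∈ Finset.range (t + 1),
        ((A - ι x * H)ᵀ) ^ (t - k) * Hᵀ * vecMulVec (e (ι x)) (y (T - (t : ℤ) - 2)) *
          (ι x)ᵀ * ((A - ι x * H)ᵀ) ^ k * Hᵀ)ᵀ * X) =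
        -(e (ι x) ⬝ᵥ Q (t + 1) (ι.symm X)) := by
      intro t
      rw [powerDeriv_apply, dotProduct_neg, neg_neg, dotProduct_sum, Matrix.transpose_sum,
        Matrix.sum_mul, Matrix.trace_sum]
      refine Finset.sum_congr rfl fun k _ => ?_
      have hT : T - ((t + 1 : ℕ) : ℤ) - 1 = T - (t : ℤ) - 2 := by push_cast; ring
      rw [hpow, hpow, hα_apply, hc_apply, hh_apply, LinearEquiv.apply_symm_apply, hT,
        Nat.add_sub_cancel]
      simp only [Matrix.transpose_mul, Matrix.transpose_vecMulVec, Matrix.transpose_pow,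
        Matrix.transpose_transpose, ← Matrix.mul_assoc]
      rw [Matrix.mul_assoc _ H, Matrix.mul_assoc _ (H * _), Matrix.mul_assoc, Matrix.trace_mul_comm,
        Matrix.mul_assoc, trace_vecMulVec_mul]
      simp only [Matrix.mulVec_mulVec, Matrix.mul_assoc]
    simp only [hterm]
    exact hshift.neg
  rw [Matrix.transpose_add, Matrix.transpose_smul, Matrix.transpose_smul, Matrix.add_mul,
    Matrix.smul_mul, Matrix.smul_mul, Matrix.trace_add, Matrix.trace_smul, Matrix.trace_smul,
    htrP, htrQ]
  simp only [_root_.sum_apply, dotProduct, smul_eq_mul, Finset.mul_sum, ← Finset.sum_neg_distrib,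
    ← Finset.sum_add_distrib]
  refine Finset.sum_congr rfl fun i _ => ?_
  simp
  ring

end MatrixMaps

theorem stmt_19 {n m : ℕ} (hn : 0 < n) (hm : 0 < m)
    (A : Matrix (Fin n) (Fin n) ℝ) (H : Matrix (Fin m) (Fin n) ℝ)
    (S : Set (Matrix (Fin n) (Fin m) ℝ))
    (hS : S = {L | specRad (A - L * H) < 1})
    (T : ℤ) (y : ℤ → Fin m → ℝ)
    (hybd : ∃ C : ℝ, ∀ (t : ℤ) (i : Fin m), |y t i| ≤ C)
    (e : Matrix (Fin n) (Fin m) ℝ → Fin m → ℝ)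
    (he : ∀ L, e L = y T -
      ∑' t : ℕ, (H * (A - L * H) ^ t * L).mulVec (y (T - (t : ℤ) - 1)))
    (ε : Matrix (Fin n) (Fin m) ℝ → ℝ)
    (hε : ∀ L, ε L = e L ⬝ᵥ e L)
    (G : Matrix (Fin n) (Fin m) ℝ → Matrix (Fin n) (Fin m) ℝ)
    (hG : ∀ L, G L =
      (-2 : ℝ) • (∑' t : ℕ,
        ((A - L * H)ᵀ) ^ t * Hᵀ * vecMulVec (e L) (y (T - (t : ℤ) - 1))) +
      (2 : ℝ) • (∑' t : ℕ, ∑ k ∈ Finset.range (t + 1),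
        ((A - L * H)ᵀ) ^ (t - k) * Hᵀ * vecMulVec (e L) (y (T - (t : ℤ) - 2)) *
          Lᵀ * ((A - L * H)ᵀ) ^ k * Hᵀ))
    (L : Matrix (Fin n) (Fin m) ℝ) (hL : L ∈ S) :
    ∃ ε' : Matrix (Fin n) (Fin m) ℝ →L[ℝ] ℝ, HasFDerivAt ε ε' L ∧
      ∀ Δ : Matrix (Fin n) (Fin m) ℝ, ε' Δ = Matrix.trace ((G L)ᵀ * Δ) := by
  rw [hS] at hL
  obtain ⟨ε', hε', hG'⟩ := hasFDerivAt_predictionError_sq (E := Fin n → Fin m → ℝ)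
    (Matrix.ofLinearEquiv ℝ) hn A H T y hybd e he L hL
  refine ⟨ε', ?_, fun Δ => ?_⟩
  · rw [show ε = fun X => e X ⬝ᵥ e X from funext hε]
    exact hε'
  · rw [hG]
    exact hG' Δ
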